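/- Let (T, C, X) be random with T ⊥ C | X, T having conditional hazard λ₀(t, β₀ᵀX) given X (a function of the index β₀ᵀX alone), C ≤ τ almost surely with S_c(τ, X) = P(C = τ | X) > 0 almost surely, Z = min(T, C), Δ = I(T ≤ C), and X_l an integrable subvector of X. Define ρ(t, β₀ᵀX) = E{X_l S_c(t, X) | β₀ᵀX} / E{S_c(t, X) | β₀ᵀX} for t ≤ τ. Then for every bounded measurable function g(s, v), E[ Δ · g(Z, β₀ᵀX) · ( X_l − ρ(Z, β₀ᵀX) ) ] = 0; equivalently, E( ∫_0^∞ g(s, β₀ᵀX) ⊗ [X_l − ρ(s, β₀ᵀX)] dN(s) ) = 0 where N(t) = I(Z ≤ t)Δ. -/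

import Mathlib

open MeasureTheory Set

/-- the σ-algebra generated by a random element. -/
def sigmaGen {Ω α : Type*} [MeasurableSpace α] (X : Ω → α) : MeasurableSpace Ω :=
  MeasurableSpace.comap X inferInstance

/-- conditional expectation given a sub-σ-algebra, as a function. -/
noncomputable def cE {Ω : Type*} [MeasurableSpace Ω] {E : Type*} [NormedAddCommGroup E]
    [NormedSpace ℝ E] [CompleteSpace E]
    (μ : Measure Ω) (m : MeasurableSpace Ω) (f : Ω → E) : Ω → E :=
  μ[f | m]


lemma aux_ac_of_dist_le {F G : ℝ → ℝ} {a b : ℝ} (hG : AbsolutelyContinuousOnInterval G a b)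
    (h : ∀ x ∈ uIcc a b, ∀ y ∈ uIcc a b, dist (F x) (F y) ≤ dist (G x) (G y)) :
    AbsolutelyContinuousOnInterval F a b := by
  rw [absolutelyContinuousOnInterval_iff] at hG ⊢
  intro ε hε
  obtain ⟨δ, hδ, H⟩ := hG ε hε
  refine ⟨δ, hδ, fun E hE hs => lt_of_le_of_lt ?_ (H E hE hs)⟩
  refine Finset.sum_le_sum fun i hi => ?_
  have := hE.1 i hi
  exact h _ this.1 _ this.2

lemma aux_exp_dist {x y : ℝ} (hx : 0 ≤ x) (hy : 0 ≤ y) :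
    dist (Real.exp (-x)) (Real.exp (-y)) ≤ dist x y := by
  wlog hxy : x ≤ y generalizing x y
  · rw [dist_comm, dist_comm x y]; exact this hy hx (le_of_not_ge hxy)
  rw [Real.dist_eq, Real.dist_eq, abs_of_nonneg (by
    rw [sub_nonneg]; exact Real.exp_le_exp.2 (by linarith)), abs_sub_comm, abs_of_nonneg (by linarith)]
  have h1 : Real.exp (-y) = Real.exp (-x) * Real.exp (-(y-x)) := by
    rw [← Real.exp_add]; ring_nf
  have h2 := Real.add_one_le_exp (-(y-x))
  have h3 : Real.exp (-x) ≤ 1 := Real.exp_le_one_iff.2 (by linarith)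
  have h4 := Real.exp_pos (-x)
  rw [h1]
  nlinarith

lemma aux_ftc {l : ℝ → ℝ} (hl0 : ∀ t, 0 ≤ l t) {b s : ℝ}
    (hs : 0 ≤ s) (hsb : s ≤ b) (hi : IntervalIntegrable l volume 0 b) :
    ∫⁻ t in Ioc s b, ENNReal.ofReal (l t * Real.exp (-∫ r in (0:ℝ)..t, l r))
      = ENNReal.ofReal (Real.exp (-∫ r in (0:ℝ)..s, l r) - Real.exp (-∫ r in (0:ℝ)..b, l r)) := by
  have hb : 0 ≤ b := hs.trans hsb
  have hac := hi.absolutelyContinuousOnInterval_intervalIntegral (c := 0) (by simp)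
  have hac2 : AbsolutelyContinuousOnInterval (fun t => - Real.exp (-∫ r in (0:ℝ)..t, l r)) 0 b := by
    refine AbsolutelyContinuousOnInterval.neg (aux_ac_of_dist_le hac ?_)
    intro x hx y hy
    rw [uIcc_of_le hb] at hx hy
    exact aux_exp_dist (intervalIntegral.integral_nonneg hx.1 fun _ _ => hl0 _)
      (intervalIntegral.integral_nonneg hy.1 fun _ _ => hl0 _)
  have hsub : uIcc s b ⊆ uIcc 0 b := by
    rw [uIcc_of_le hb, uIcc_of_le hsb]; exact Icc_subset_Icc_left hs
  have hac3 := hac2.mono hsub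
  have hder := hi.ae_hasDerivAt_integral
  have hae : ∀ᵐ x, x ∈ Ioc s b → deriv (fun t => - Real.exp (-∫ r in (0:ℝ)..t, l r)) x
      = l x * Real.exp (-∫ r in (0:ℝ)..x, l r) := by
    filter_upwards [hder] with x hx hx2
    have h1 := hx (hsub (by rw [uIcc_of_le hsb]; exact Ioc_subset_Icc_self hx2)) 0 (by simp)
    have h2 := h1.fun_neg.exp.fun_neg
    rw [h2.deriv]; ring
  have hae' : ∀ᵐ x ∂(volume.restrict (Ioc s b)), deriv (fun t => - Real.exp (-∫ r in (0:ℝ)..t, l r)) x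
      = l x * Real.exp (-∫ r in (0:ℝ)..x, l r) := (ae_restrict_iff' measurableSet_Ioc).2 hae
  have hint := hac3.intervalIntegrable_deriv
  have heq := hac3.integral_deriv_eq_sub
  rw [intervalIntegral.integral_of_le hsb] at heq
  have hint2 := (intervalIntegrable_iff_integrableOn_Ioc_of_le hsb).1 hint
  rw [integral_congr_ae hae'] at heq
  rw [← ofReal_integral_eq_lintegral_ofReal (hint2.congr hae')
    (Filter.Eventually.of_forall fun t => mul_nonneg (hl0 t) (Real.exp_pos _).le), heq]
  congr 1; ring

lemma aux_tail {l : ℝ → ℝ} (hlm : Measurable l) (hl0 : ∀ t, 0 ≤ l t) {u : ℕ → ℝ}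
    (hu : Filter.Tendsto u Filter.atTop Filter.atTop)
    (hlim : Filter.Tendsto (fun k => Real.exp (-∫ r in (0:ℝ)..(u k), l r)) Filter.atTop (nhds 0))
    (hm : Measurable fun t => Real.exp (-∫ r in (0:ℝ)..t, l r))
    {s : ℝ} (hs : 0 ≤ s) :
    ∫⁻ t in Ici s, ENNReal.ofReal (l t * Real.exp (-∫ r in (0:ℝ)..t, l r))
      = ENNReal.ofReal (Real.exp (-∫ r in (0:ℝ)..s, l r)) := by
  have hint : ∀ b, 0 ≤ b → IntervalIntegrable l volume 0 b := by
    intro b hb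
    by_contra hcon
    have h1 : ∀ᶠ k in Filter.atTop, Real.exp (-∫ r in (0:ℝ)..(u k), l r) = 1 := by
      filter_upwards [hu.eventually_ge_atTop b] with k hk
      rw [intervalIntegral.integral_undef]
      · simp
      · intro h; exact hcon (h.mono_set (by
          rw [uIcc_of_le hb, uIcc_of_le (hb.trans hk)]; exact Icc_subset_Icc_right hk))
    have h2 := tendsto_nhds_unique (hlim.congr' h1) tendsto_const_nhds
    norm_num at h2
  rw [setLIntegral_congr Ioi_ae_eq_Ici.symm]
  have hcov : AECover (volume.restrict (Ioi s)) Filter.atTop fun k => Iic (u k) := aecover_Iic hu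
  refine hcov.lintegral_eq_of_tendsto _ (by fun_prop) ?_
  have h3 : Filter.Tendsto (fun k => ENNReal.ofReal (Real.exp (-∫ r in (0:ℝ)..s, l r)
     - Real.exp (-∫ r in (0:ℝ)..(u k), l r))) Filter.atTop
      (nhds (ENNReal.ofReal (Real.exp (-∫ r in (0:ℝ)..s, l r)))) := by
    refine ENNReal.tendsto_ofReal ?_
    simpa using tendsto_const_nhds.sub hlim
  refine h3.congr' ?_
  filter_upwards [hu.eventually_ge_atTop s] with k hk
  rw [Measure.restrict_restrict measurableSet_Iic, Iic_inter_Ioi,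
    aux_ftc hl0 hs hk (hint _ (hs.trans hk))]

lemma aux_ext {E : Type*} [MeasurableSpace E] {P Q : Measure (ℝ × ℝ × E)} [IsFiniteMeasure P]
    (h : ∀ s t (A : Set E), MeasurableSet A → P (Ici s ×ˢ Ici t ×ˢ A) = Q (Ici s ×ˢ Ici t ×ˢ A)) :
    P = Q := by
  have h1 : ∀ (B : Set ℝ) t (A : Set E), MeasurableSet B → MeasurableSet A →
      P (B ×ˢ Ici t ×ˢ A) = Q (B ×ˢ Ici t ×ˢ A) := by
    intro B t A hB hA
    have key : ∀ (R : Measure (ℝ × ℝ × E)) (B : Set ℝ), MeasurableSet B →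
        ((R.restrict (univ ×ˢ Ici t ×ˢ A)).map Prod.fst) B = R (B ×ˢ Ici t ×ˢ A) := by
      intro R B hB
      rw [Measure.map_apply measurable_fst hB, Measure.restrict_apply (measurable_fst hB)]
      congr 1; ext x; simp
    rw [← key P B hB, ← key Q B hB]
    congr 1
    refine Measure.ext_of_Ici _ _ fun a => ?_
    rw [key _ _ measurableSet_Ici, key _ _ measurableSet_Ici, h _ _ _ hA]
  refine Measure.ext_prod₃ fun {B D A} hB hD hA => ?_
  have key : ∀ (R : Measure (ℝ × ℝ × E)) (D : Set ℝ), MeasurableSet D →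
      ((R.restrict (B ×ˢ univ ×ˢ A)).map (fun x => x.2.1)) D = R (B ×ˢ D ×ˢ A) := by
    intro R D hD
    have hm : Measurable (fun x : ℝ × ℝ × E => x.2.1) := by fun_prop
    rw [Measure.map_apply hm hD, Measure.restrict_apply (hm hD)]
    congr 1; ext x; simp; tauto
  rw [← key P D hD, ← key Q D hD]
  congr 1
  refine Measure.ext_of_Ici _ _ fun a => ?_
  rw [key _ _ measurableSet_Ici, key _ _ measurableSet_Ici, h1 _ _ _ hB hA]

lemma aux_meas_int {W : Type*} [MeasurableSpace W] {lam : ℝ → W → ℝ}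
    (h : Measurable (Function.uncurry lam)) :
    Measurable (fun q : ℝ × W => ∫ r in (0:ℝ)..q.1, lam r q.2) := by
  have key : ∀ (S : Set ((ℝ × W) × ℝ)), MeasurableSet S →
      Measurable (fun q : ℝ × W => ∫ r, S.indicator (fun z => lam z.2 z.1.2) (q, r)) := by
    intro S hS
    have h1 : Measurable (fun z : (ℝ × W) × ℝ => lam z.2 z.1.2) :=
      h.comp (measurable_snd.prodMk (measurable_snd.comp measurable_fst))
    exact ((h1.indicator hS).stronglyMeasurable.integral_prod_right' (ν := volume)).measurable
  have hS1 : MeasurableSet {z : (ℝ × W) × ℝ | 0 < z.2 ∧ z.2 ≤ z.1.1} := by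
    rw [Set.ofPred_and]; exact (measurableSet_lt (by fun_prop) (by fun_prop)).inter
      (measurableSet_le (by fun_prop) (by fun_prop))
  have hS2 : MeasurableSet {z : (ℝ × W) × ℝ | z.1.1 < z.2 ∧ z.2 ≤ 0} := by
    rw [Set.ofPred_and]; exact (measurableSet_lt (by fun_prop) (by fun_prop)).inter
      (measurableSet_le (by fun_prop) (by fun_prop))
  convert (key _ hS1).sub (key _ hS2) using 1
  ext q
  simp only [intervalIntegral, Pi.sub_apply]
  rw [← integral_indicator measurableSet_Ioc, ← integral_indicator measurableSet_Ioc]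
  congr 1

lemma aux_pull {Ω : Type*} {m m0 : MeasurableSpace Ω} {μ : Measure Ω} [IsFiniteMeasure μ]
    (hm : m ≤ m0) {w Q : Ω → ℝ} (hw : StronglyMeasurable[m] w) (hQ : Integrable Q μ) (c : ℝ)
    (hb : ∀ ω, |w ω| ≤ c) :
    ∫ ω, w ω * Q ω ∂μ = ∫ ω, w ω * (μ[Q | m]) ω ∂μ := by
  have h1 := condExp_stronglyMeasurable_mul_of_bound hm hw hQ c (Filter.Eventually.of_forall hb)
  have h2 := integral_condExp (f := w * Q) (μ := μ) hm
  rw [integral_congr_ae h1] at h2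
  exact h2.symm

lemma aux_zero {Ω : Type*} {m m0 : MeasurableSpace Ω} {μ : Measure Ω} [IsFiniteMeasure μ]
    (hm : m ≤ m0) {w r Y Q : Ω → ℝ} (hw : Measurable[m] w)
    (hr : Measurable[m] r) (hY : Integrable Y μ) (hQ : Integrable Q μ)
    (he : (fun ω => r ω * (μ[Q | m]) ω) =ᵐ[μ] μ[Y | m])
    (hint : Integrable (fun ω => w ω * (Y ω - r ω * Q ω)) μ) :
    ∫ ω, w ω * (Y ω - r ω * Q ω) ∂μ = 0 := by
  let A : ℕ → Set Ω := fun n => {ω | |w ω| ≤ n} ∩ {ω | |r ω| ≤ n}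
  have hA : ∀ n, MeasurableSet[m] (A n) := by
    intro n
    have h1 : MeasurableSet {x : ℝ | |x| ≤ n} := measurableSet_le (by fun_prop) (by fun_prop)
    exact MeasurableSet.inter (hw h1) (hr h1)
  have hmono : Monotone A := by
    intro a b hab ω hω
    have : (a:ℝ) ≤ b := by exact_mod_cast hab
    exact ⟨le_trans hω.1 this, le_trans hω.2 this⟩
  have hU : ⋃ n, A n = univ := by
    refine eq_univ_of_forall fun ω => mem_iUnion.2 ?_
    obtain ⟨n, hn⟩ := exists_nat_ge (max |w ω| |r ω|)
    exact ⟨n, (le_max_left _ _).trans hn, (le_max_right _ _).trans hn⟩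
  have hlim := tendsto_setIntegral_of_monotone (fun n => hm _ (hA n)) hmono
    (hint.integrableOn (s := ⋃ n, A n))
  rw [hU, setIntegral_univ] at hlim
  have hz : ∀ n, ∫ ω in A n, w ω * (Y ω - r ω * Q ω) ∂μ = 0 := by
    intro n
    rw [← integral_indicator (hm _ (hA n))]
    have hw1 : Measurable[m] ((A n).indicator w) := hw.indicator (hA n)
    have hw2 : Measurable[m] ((A n).indicator (fun ω => w ω * r ω)) := (hw.mul hr).indicator (hA n)
    have b1 : ∀ ω, |(A n).indicator w ω| ≤ n := by
      intro ω
      by_cases h : ω ∈ A n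
      · simpa [h] using h.1
      · simp [h]
    have b2 : ∀ ω, |(A n).indicator (fun ω => w ω * r ω) ω| ≤ n * n := by
      intro ω
      by_cases h : ω ∈ A n
      · simp only [h, indicator_of_mem, abs_mul]
        exact mul_le_mul h.1 h.2 (abs_nonneg _) (Nat.cast_nonneg _)
      · simp only [h, not_false_eq_true, indicator_of_notMem, abs_zero]; positivity
    have i1 : Integrable (fun ω => (A n).indicator w ω * Y ω) μ :=
      hY.bdd_mul (hw1.mono hm le_rfl).aestronglyMeasurable (Filter.Eventually.of_forall b1)
    have i2 : Integrable (fun ω => (A n).indicator (fun ω => w ω * r ω) ω * Q ω) μ :=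
      hQ.bdd_mul (hw2.mono hm le_rfl).aestronglyMeasurable (Filter.Eventually.of_forall b2)
    have e1 : (A n).indicator (fun ω => w ω * (Y ω - r ω * Q ω)) =
        fun ω => (A n).indicator w ω * Y ω - (A n).indicator (fun ω => w ω * r ω) ω * Q ω := by
      ext ω
      by_cases h : ω ∈ A n
      · simp [h]; ring
      · simp [h]
    rw [e1, integral_sub i1 i2, aux_pull hm hw1.stronglyMeasurable hY n b1,
      aux_pull hm hw2.stronglyMeasurable hQ _ b2, sub_eq_zero]
    refine integral_congr_ae ?_
    filter_upwards [he] with ω hω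
    rw [← hω]
    by_cases h : ω ∈ A n
    · simp [h]; ring
    · simp [h]
  simp only [hz] at hlim
  exact (tendsto_nhds_unique hlim tendsto_const_nhds)

lemma aux_seq {Ω W : Type*} {m m0 : MeasurableSpace Ω} [MeasurableSpace W]
    (μ : Measure Ω) [IsProbabilityMeasure μ]
    (hm : m ≤ m0)
    {T : Ω → ℝ} {V : Ω → W} (hT : Measurable T) (hV : Measurable V)
    {lam : ℝ → W → ℝ} (hlm : Measurable (Function.uncurry lam))
    (hSurv : ∀ t : ℝ, 0 ≤ t →
      μ[(fun ω => if t ≤ T ω then (1:ℝ) else 0) | m]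
        =ᵐ[μ] fun ω => Real.exp (- ∫ s in (0:ℝ)..t, lam s (V ω))) :
    ∃ u : ℕ → ℝ, Filter.Tendsto u Filter.atTop Filter.atTop ∧ ∀ᵐ ω ∂μ,
      Filter.Tendsto (fun k => Real.exp (-∫ r in (0:ℝ)..(u k), lam r (V ω))) Filter.atTop (nhds 0) := by
  let F : ℕ → Ω → ℝ := fun n ω => Real.exp (- ∫ s in (0:ℝ)..n, lam s (V ω))
  have hFm : ∀ n, Measurable (F n) := fun n =>
    ((aux_meas_int hlm).comp (measurable_const.prodMk hV)).neg.exp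
  have hFi : ∀ n, Integrable (F n) μ := fun n =>
    (integrable_condExp (m := m)).congr (hSurv n (Nat.cast_nonneg n))
  have hlim : Filter.Tendsto (fun n : ℕ => ∫ ω, F n ω ∂μ) Filter.atTop (nhds 0) := by
    have h1 : ∀ n : ℕ, ∫ ω, F n ω ∂μ = ∫ ω, (if (n:ℝ) ≤ T ω then (1:ℝ) else 0) ∂μ := by
      intro n
      rw [← integral_congr_ae (hSurv n (Nat.cast_nonneg n)), integral_condExp hm]
    simp only [h1]
    rw [show nhds (0:ℝ) = nhds (∫ ω, (fun _ : Ω => (0:ℝ)) ω ∂μ) by simp]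
    refine tendsto_integral_of_dominated_convergence (fun _ => 1) ?_ (integrable_const _) ?_ ?_
    · intro n
      exact (Measurable.ite (measurableSet_le measurable_const hT) measurable_const
        measurable_const).aestronglyMeasurable
    · intro n
      refine Filter.Eventually.of_forall fun ω => ?_
      split_ifs <;> simp
    · refine Filter.Eventually.of_forall fun ω => ?_
      refine tendsto_const_nhds.congr' ?_
      obtain ⟨N, hN⟩ := exists_nat_gt (T ω)
      filter_upwards [Filter.eventually_ge_atTop N] with n hn
      have : (N:ℝ) ≤ n := by exact_mod_cast hn
      rw [if_neg (by linarith)]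
  have hmeas : TendstoInMeasure μ F Filter.atTop (fun _ => (0:ℝ)) := by
    refine tendstoInMeasure_of_tendsto_eLpNorm (p := 1) one_ne_zero
      (fun n => (hFm n).aestronglyMeasurable) aestronglyMeasurable_const ?_
    have h2 : ∀ n, eLpNorm (F n - fun _ => (0:ℝ)) 1 μ = ENNReal.ofReal (∫ ω, F n ω ∂μ) := by
      intro n
      rw [eLpNorm_one_eq_lintegral_enorm, ofReal_integral_eq_lintegral_ofReal (hFi n)
        (Filter.Eventually.of_forall fun ω => (Real.exp_pos _).le)]
      refine lintegral_congr fun ω => ?_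
      simp only [Pi.sub_apply, sub_zero]
      exact Real.enorm_of_nonneg (Real.exp_pos _).le
    simp only [h2]
    simpa using ENNReal.tendsto_ofReal hlim
  obtain ⟨ns, hns, hae⟩ := hmeas.exists_seq_tendsto_ae
  exact ⟨fun k => (ns k : ℝ), tendsto_natCast_atTop_atTop.comp hns.tendsto_atTop, hae⟩

noncomputable def auxDens {W : Type*} (lam : ℝ → W → ℝ) (t : ℝ) (v : W) : ℝ :=
  if 0 ≤ t then lam t v * Real.exp (-∫ r in (0:ℝ)..t, lam r v) else 0

lemma auxDens_meas {W : Type*} [MeasurableSpace W] {lam : ℝ → W → ℝ}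
    (hlm : Measurable (Function.uncurry lam)) : Measurable (fun q : ℝ × W => auxDens lam q.1 q.2) := by
  unfold auxDens
  exact Measurable.ite (measurableSet_le measurable_const measurable_fst)
    (hlm.mul (aux_meas_int hlm).neg.exp) measurable_const

lemma auxDens_nonneg {W : Type*} {lam : ℝ → W → ℝ} (h0 : ∀ s v, 0 ≤ lam s v) (t : ℝ) (v : W) :
    0 ≤ auxDens lam t v := by
  unfold auxDens
  split_ifs
  · exact mul_nonneg (h0 _ _) (Real.exp_pos _).le
  · exact le_rfl

lemma auxDens_tail {W : Type*} [MeasurableSpace W] {lam : ℝ → W → ℝ}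
    (hlm : Measurable (Function.uncurry lam)) (h0 : ∀ s v, 0 ≤ lam s v)
    {u : ℕ → ℝ} (hu : Filter.Tendsto u Filter.atTop Filter.atTop) {v : W}
    (hlim : Filter.Tendsto (fun k => Real.exp (-∫ r in (0:ℝ)..(u k), lam r v)) Filter.atTop (nhds 0))
    (s : ℝ) :
    ∫⁻ t in Ici s, ENNReal.ofReal (auxDens lam t v)
      = ENNReal.ofReal (Real.exp (-∫ r in (0:ℝ)..(max s 0), lam r v)) := by
  rw [← aux_tail (l := fun r => lam r v) (hlm.comp (measurable_id.prodMk measurable_const))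
    (fun t => h0 t v) hu hlim
    ((aux_meas_int hlm).comp (measurable_id.prodMk measurable_const)).neg.exp (le_max_right s 0)]
  rw [← lintegral_indicator measurableSet_Ici, ← lintegral_indicator measurableSet_Ici]
  refine lintegral_congr fun t => ?_
  simp only [indicator, mem_Ici, auxDens, max_le_iff]
  by_cases h1 : s ≤ t <;> by_cases h2 : 0 ≤ t <;> simp [h1, h2]

lemma aux_law {Ω E W : Type*} [MeasurableSpace Ω] [MeasurableSpace E] [MeasurableSpace W]
    (μ : Measure Ω) [IsProbabilityMeasure μ]
    {X : Ω → E} {T C : Ω → ℝ} {L : E → W}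
    (hX : Measurable X) (hT : Measurable T) (hC : Measurable C) (hL : Measurable L)
    (hTnn : ∀ ω, 0 ≤ T ω)
    (hTC : ∀ s t : ℝ,
      μ[(fun ω => (if s ≤ T ω then (1:ℝ) else 0) * (if t ≤ C ω then (1:ℝ) else 0)) |
          MeasurableSpace.comap X inferInstance]
        =ᵐ[μ]
      fun ω =>
        (μ[(fun ω' => if s ≤ T ω' then (1:ℝ) else 0) | MeasurableSpace.comap X inferInstance]) ω *
        (μ[(fun ω' => if t ≤ C ω' then (1:ℝ) else 0) | MeasurableSpace.comap X inferInstance]) ω)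
    {lam : ℝ → W → ℝ} (hlm : Measurable (Function.uncurry lam)) (h0 : ∀ s v, 0 ≤ lam s v)
    (hSurv : ∀ t : ℝ, 0 ≤ t →
      μ[(fun ω => if t ≤ T ω then (1:ℝ) else 0) | MeasurableSpace.comap X inferInstance]
        =ᵐ[μ] fun ω => Real.exp (- ∫ s in (0:ℝ)..t, lam s (L (X ω)))) :
    μ.map (fun ω => (T ω, C ω, X ω)) =
      ((volume : Measure ℝ).prod (μ.map (fun ω => (C ω, X ω)))).withDensity
        (fun q => ENNReal.ofReal (auxDens lam q.1 (L q.2.2))) := by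
  have hm : MeasurableSpace.comap X inferInstance ≤ ‹MeasurableSpace Ω› := hX.comap_le
  have hW : Measurable (fun ω => (C ω, X ω)) := hC.prodMk hX
  have hTW : Measurable (fun ω => (T ω, C ω, X ω)) := hT.prodMk hW
  have : IsProbabilityMeasure (μ.map (fun ω => (C ω, X ω))) :=
    Measure.isProbabilityMeasure_map hW.aemeasurable
  have : IsProbabilityMeasure (μ.map (fun ω => (T ω, C ω, X ω))) :=
    Measure.isProbabilityMeasure_map hTW.aemeasurable
  obtain ⟨u, hu, hae⟩ := aux_seq μ hm hT (hL.comp hX) hlm hSurv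
  have hdm : Measurable (fun q : ℝ × ℝ × E => ENNReal.ofReal (auxDens lam q.1 (L q.2.2))) :=
    ((auxDens_meas hlm).comp (measurable_fst.prodMk
      (hL.comp (measurable_snd.comp measurable_snd)))).ennreal_ofReal
  refine aux_ext fun s t A hA => ?_
  have hR : MeasurableSet (Ici s ×ˢ Ici t ×ˢ A) :=
    measurableSet_Ici.prod (measurableSet_Ici.prod hA)
  set s' := max s 0 with hs'
  have hs0 : 0 ≤ s' := le_max_right _ _
  let w : Ω → ℝ := (X ⁻¹' A).indicator 1
  let S : Ω → ℝ := fun ω => Real.exp (- ∫ r in (0:ℝ)..s', lam r (L (X ω)))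
  let IT : Ω → ℝ := fun ω => if s' ≤ T ω then (1:ℝ) else 0
  let IC : Ω → ℝ := fun ω => if t ≤ C ω then (1:ℝ) else 0
  have hwm : Measurable[MeasurableSpace.comap X inferInstance] w :=
    Measurable.indicator (measurable_const (a := (1:ℝ))) ⟨A, hA, rfl⟩
  have hSm : Measurable[MeasurableSpace.comap X inferInstance] S := by
    have h1 : Measurable (fun x : E => Real.exp (- ∫ r in (0:ℝ)..s', lam r (L x))) :=
      ((aux_meas_int hlm).comp (measurable_const.prodMk hL)).neg.exp
    exact h1.comp (comap_measurable X)
  have hITm : Measurable IT :=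
    Measurable.ite (measurableSet_le measurable_const hT) measurable_const measurable_const
  have hICm : Measurable IC :=
    Measurable.ite (measurableSet_le measurable_const hC) measurable_const measurable_const
  have bw : ∀ ω, |w ω| ≤ 1 := by
    intro ω
    by_cases h : ω ∈ X ⁻¹' A
    · simp [w, indicator_of_mem h]
    · simp [w, indicator_of_notMem h]
  have w0 : ∀ ω, 0 ≤ w ω := fun ω => indicator_nonneg (fun _ _ => zero_le_one) ω
  have S0 : ∀ ω, 0 ≤ S ω := fun ω => (Real.exp_pos _).le
  have bS : ∀ ω, |S ω| ≤ 1 := by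
    intro ω
    rw [abs_of_nonneg (S0 ω)]
    refine Real.exp_le_one_iff.2 (neg_nonpos.2 ?_)
    exact intervalIntegral.integral_nonneg hs0 fun _ _ => h0 _ _
  have IT0 : ∀ ω, 0 ≤ IT ω := fun ω => by simp only [IT]; split_ifs <;> simp
  have IC0 : ∀ ω, 0 ≤ IC ω := fun ω => by simp only [IC]; split_ifs <;> simp
  have bIT : ∀ ω, |IT ω| ≤ 1 := fun ω => by simp only [IT]; split_ifs <;> simp
  have bIC : ∀ ω, |IC ω| ≤ 1 := fun ω => by simp only [IC]; split_ifs <;> simp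
  have bdd : ∀ {a b : ℝ}, |a| ≤ 1 → |b| ≤ 1 → |a * b| ≤ 1 := by
    intro a b ha hb
    rw [abs_mul]; exact mul_le_one₀ ha (abs_nonneg _) hb
  have intg : ∀ {f : Ω → ℝ}, Measurable f → (∀ ω, |f ω| ≤ 1) → Integrable f μ := by
    intro f hf hb
    exact (integrable_const (1:ℝ)).mono' hf.aestronglyMeasurable (Filter.Eventually.of_forall hb)
  have hwm' : Measurable w := hwm.mono hm le_rfl
  have hSm' : Measurable S := hSm.mono hm le_rfl
  have main : ∫ ω, w ω * (IT ω * IC ω) ∂μ = ∫ ω, (w ω * S ω) * IC ω ∂μ := by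
    rw [aux_pull (Q := fun ω => IT ω * IC ω) hm hwm.stronglyMeasurable
      (intg (hITm.mul hICm) fun ω => bdd (bIT ω) (bIC ω)) 1 bw,
      aux_pull (w := fun ω => w ω * S ω) hm (hwm.mul hSm).stronglyMeasurable (intg hICm bIC) 1 fun ω => bdd (bw ω) (bS ω)]
    refine integral_congr_ae ?_
    filter_upwards [hTC s' t, hSurv s' hs0] with ω h1 h2
    simp only [IT, IC]
    rw [h1, h2, mul_assoc]
  have lhs : μ.map (fun ω => (T ω, C ω, X ω)) (Ici s ×ˢ Ici t ×ˢ A)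
      = ENNReal.ofReal (∫ ω, w ω * (IT ω * IC ω) ∂μ) := by
    rw [Measure.map_apply hTW hR, ← lintegral_indicator_one (hTW hR),
      ofReal_integral_eq_lintegral_ofReal
        (intg (f := fun ω => w ω * (IT ω * IC ω)) (hwm'.mul (hITm.mul hICm)) fun ω => bdd (bw ω) (bdd (bIT ω) (bIC ω)))
        (Filter.Eventually.of_forall fun ω => mul_nonneg (w0 ω) (mul_nonneg (IT0 ω) (IC0 ω)))]
    refine lintegral_congr fun ω => ?_
    have := hTnn ω
    simp only [indicator, mem_preimage, mem_prod, mem_Ici, w, IT, IC, hs', max_le_iff, this, and_true,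
      Pi.one_apply]
    by_cases h1 : s ≤ T ω <;> by_cases h2 : t ≤ C ω <;> by_cases h3 : X ω ∈ A <;> simp [h1, h2, h3]
  rw [lhs, main, withDensity_apply _ hR, ← Measure.prod_restrict, lintegral_prod_symm _ hdm.aemeasurable,
    ← lintegral_indicator (measurableSet_Ici.prod hA), lintegral_map _ hW,
    ofReal_integral_eq_lintegral_ofReal
        (intg (f := fun ω => w ω * S ω * IC ω) ((hwm'.mul hSm').mul hICm) fun ω => bdd (bdd (bw ω) (bS ω)) (bIC ω))
        (Filter.Eventually.of_forall fun ω => mul_nonneg (mul_nonneg (w0 ω) (S0 ω)) (IC0 ω))]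
  · refine lintegral_congr_ae ?_
    filter_upwards [hae] with ω hω
    simp only [indicator, mem_prod, mem_Ici]
    rw [auxDens_tail (v := L (X ω)) hlm h0 hu hω s]
    simp only [w, IC, indicator, mem_preimage, S, Pi.one_apply]
    by_cases h2 : t ≤ C ω <;> by_cases h3 : X ω ∈ A <;> simp [h2, h3, hs']
  · exact Measurable.indicator hdm.lintegral_prod_left' (measurableSet_Ici.prod hA)

/-- With `T ⊥ C | X`, `T` having conditional hazard `λ₀(t, β₀ᵀX)` given `X`
(a function of the index `β₀ᵀX` alone), `C ≤ τ` a.s. with `P(C = τ | X) > 0` a.s.,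
`Z = min(T, C)`, `Δ = I(T ≤ C)`, `X_l` an integrable subvector component of `X`, and
`ρ(t, β₀ᵀX) = E{X_l S_c(t, X) | β₀ᵀX} / E{S_c(t, X) | β₀ᵀX}` for `t ≤ τ`:
for every bounded measurable `g`,
`E[Δ · g(Z, β₀ᵀX) · (X_l − ρ(Z, β₀ᵀX))] = 0` — that is,
`E(∫_0^∞ g(s, β₀ᵀX) ⊗ [X_l − ρ(s, β₀ᵀX)] dN(s)) = 0` with `N(t) = I(Z ≤ t)Δ`. -/
theorem expected_efficient_score_counting_process_zero
    {Ω : Type*} [MeasurableSpace Ω] (μ : Measure Ω) [IsProbabilityMeasure μ]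
    {p d : ℕ} (X : Ω → Fin p → ℝ) (T C : Ω → ℝ)
    (β₀ : Matrix (Fin p) (Fin d) ℝ)
    (hX : Measurable X) (hT : Measurable T) (hC : Measurable C)
    (hTnn : ∀ ω, 0 ≤ T ω) (hCnn : ∀ ω, 0 ≤ C ω)
    -- the index V = β₀ᵀX
    (V : Ω → Fin d → ℝ) (hV : ∀ ω, V ω = Matrix.vecMul (X ω) β₀)
    (hVmeas : Measurable V)
    -- conditional independence of T and C given X
    (hTC : ∀ s t : ℝ,
      cE μ (sigmaGen X)
          (fun ω => (if s ≤ T ω then (1:ℝ) else 0) * (if t ≤ C ω then (1:ℝ) else 0))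
        =ᵐ[μ]
      fun ω =>
        cE μ (sigmaGen X) (fun ω' => if s ≤ T ω' then (1:ℝ) else 0) ω *
        cE μ (sigmaGen X) (fun ω' => if t ≤ C ω' then (1:ℝ) else 0) ω)
    -- T has an absolutely continuous conditional distribution given X whose hazard
    -- λ₀(t, β₀ᵀX) depends on X only through β₀ᵀX
    (lam₀ : ℝ → (Fin d → ℝ) → ℝ) (hlam₀meas : Measurable (Function.uncurry lam₀))
    (hlam₀nn : ∀ s v, 0 ≤ lam₀ s v)
    (hSurv : ∀ t : ℝ, 0 ≤ t →
      cE μ (sigmaGen X) (fun ω => if t ≤ T ω then (1:ℝ) else 0)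
        =ᵐ[μ] fun ω => Real.exp (- ∫ s in (0:ℝ)..t, lam₀ s (V ω)))
    -- bounded follow-up: C ≤ τ a.s. and P(C = τ | X) > 0 a.s.
    (τ : ℝ) (hτpos : 0 < τ)
    (hCτ : ∀ᵐ ω ∂μ, C ω ≤ τ)
    (hatom : ∀ᵐ ω ∂μ,
      0 < cE μ (sigmaGen X) (fun ω' => if C ω' = τ then (1:ℝ) else 0) ω)
    -- an integrable subvector component of X
    (Xl : Ω → ℝ) (hXlmeas : Measurable[sigmaGen X] Xl) (hXlint : Integrable Xl μ)
    -- ρ(t, β₀ᵀX) = E{X_l S_c(t, X) | β₀ᵀX} / E{S_c(t, X) | β₀ᵀX} for t ≤ τ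
    (ρ : ℝ → (Fin d → ℝ) → ℝ) (hρmeas : Measurable (Function.uncurry ρ))
    (hρ : ∀ t : ℝ, t ≤ τ →
      (fun ω => ρ t (V ω)) =ᵐ[μ]
      fun ω =>
        cE μ (sigmaGen V)
            (fun ω' => Xl ω' *
              cE μ (sigmaGen X) (fun ω'' => if t ≤ C ω'' then (1:ℝ) else 0) ω') ω /
        cE μ (sigmaGen V)
            (fun ω' =>
              cE μ (sigmaGen X) (fun ω'' => if t ≤ C ω'' then (1:ℝ) else 0) ω') ω) :
    ∀ g : ℝ → (Fin d → ℝ) → ℝ, Measurable (Function.uncurry g) →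
      (∃ M : ℝ, ∀ s v, |g s v| ≤ M) →
      ∫ ω, (if T ω ≤ C ω then (1:ℝ) else 0) * g (min (T ω) (C ω)) (V ω) *
            (Xl ω - ρ (min (T ω) (C ω)) (V ω)) ∂μ = 0 := by
  intro g hg ⟨M, hM⟩
  have hL : Measurable (fun x : Fin p → ℝ => Matrix.vecMul x β₀) := by
    refine measurable_pi_lambda _ fun j => ?_
    simp only [Matrix.vecMul, dotProduct]
    fun_prop
  set L : (Fin p → ℝ) → (Fin d → ℝ) := fun x => Matrix.vecMul x β₀ with hLdef
  have hVL : ∀ ω, V ω = L (X ω) := hV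
  obtain ⟨xl, hxl, rfl⟩ := hXlmeas.exists_eq_measurable_comp
  have hSurv' : ∀ t : ℝ, 0 ≤ t →
      μ[(fun ω => if t ≤ T ω then (1:ℝ) else 0) | MeasurableSpace.comap X inferInstance]
        =ᵐ[μ] fun ω => Real.exp (- ∫ s in (0:ℝ)..t, lam₀ s (L (X ω))) := by
    intro t ht
    have := hSurv t ht
    simp only [hVL] at this
    exact this
  have law := aux_law μ hX hT hC hL hTnn hTC hlam₀meas hlam₀nn hSurv'
  have hW : Measurable (fun ω => (C ω, X ω)) := hC.prodMk hX
  have hTW : Measurable (fun ω => (T ω, C ω, X ω)) := hT.prodMk hW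
  have : IsProbabilityMeasure (μ.map (fun ω => (C ω, X ω))) :=
    Measure.isProbabilityMeasure_map hW.aemeasurable
  let H : ℝ × ℝ × (Fin p → ℝ) → ℝ := fun q =>
    (if q.1 ≤ q.2.1 then (1:ℝ) else 0) * g q.1 (L q.2.2) * (xl q.2.2 - ρ q.1 (L q.2.2))
  have htL : Measurable (fun q : ℝ × ℝ × (Fin p → ℝ) => (q.1, L q.2.2)) :=
    measurable_fst.prodMk (hL.comp (measurable_snd.comp measurable_snd))
  have hH : Measurable H :=
    ((Measurable.ite (measurableSet_le measurable_fst (measurable_fst.comp measurable_snd))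
      measurable_const measurable_const).mul (hg.comp htL)).mul
      ((hxl.comp (measurable_snd.comp measurable_snd)).sub (hρmeas.comp htL))
  have hdm : Measurable (fun q : ℝ × ℝ × (Fin p → ℝ) => auxDens lam₀ q.1 (L q.2.2)) :=
    (auxDens_meas hlam₀meas).comp htL
  have e1 : ∫ ω, (if T ω ≤ C ω then (1:ℝ) else 0) * g (min (T ω) (C ω)) (V ω) *
            ((xl ∘ X) ω - ρ (min (T ω) (C ω)) (V ω)) ∂μ
      = ∫ q, H q ∂(μ.map (fun ω => (T ω, C ω, X ω))) := by
    rw [integral_map hTW.aemeasurable hH.aestronglyMeasurable]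
    refine integral_congr_ae (Filter.Eventually.of_forall fun ω => ?_)
    simp only [H, hVL]
    by_cases h : T ω ≤ C ω
    · simp [h]
    · simp [h]
  rw [e1, law, integral_withDensity_eq_integral_toReal_smul hdm.ennreal_ofReal
    (Filter.Eventually.of_forall fun _ => ENNReal.ofReal_lt_top)]
  by_cases hI : Integrable (fun q : ℝ × ℝ × (Fin p → ℝ) =>
      (ENNReal.ofReal (auxDens lam₀ q.1 (L q.2.2))).toReal • H q)
      ((volume : Measure ℝ).prod (μ.map (fun ω => (C ω, X ω))))
  swap
  · exact integral_undef hI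
  rw [integral_prod _ hI]
  refine integral_eq_zero_of_ae ?_
  filter_upwards [hI.prod_right_ae] with t ht
  simp only [Pi.zero_apply]
  have hmt : Measurable (fun z : ℝ × (Fin p → ℝ) =>
      (ENNReal.ofReal (auxDens lam₀ t (L z.2))).toReal • H (t, z)) :=
    (hdm.ennreal_ofReal.ennreal_toReal.smul hH).comp (measurable_const.prodMk measurable_id)
  rw [integral_map hW.aemeasurable hmt.aestronglyMeasurable]
  have hti := (integrable_map_measure hmt.aestronglyMeasurable hW.aemeasurable).1 ht
  by_cases htτ : t ≤ τ
  swap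
  · refine integral_eq_zero_of_ae ?_
    filter_upwards [hCτ] with ω hω
    simp [H, show ¬ t ≤ C ω by linarith]
  have hmX : sigmaGen X ≤ ‹MeasurableSpace Ω› := hX.comap_le
  have hmV : sigmaGen V ≤ ‹MeasurableSpace Ω› := hVmeas.comap_le
  have hVX : sigmaGen V ≤ sigmaGen X := by
    have : Measurable[sigmaGen X] V := by
      have h1 : V = L ∘ X := funext hVL
      rw [h1]; exact hL.comp (comap_measurable X)
    exact this.comap_le
  let Q : Ω → ℝ := fun ω => if t ≤ C ω then (1:ℝ) else 0
  have hQm : Measurable Q :=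
    Measurable.ite (measurableSet_le measurable_const hC) measurable_const measurable_const
  have bQ : ∀ ω, ‖Q ω‖ ≤ 1 := fun ω => by simp only [Q]; split_ifs <;> simp
  have hQ : Integrable Q μ :=
    (integrable_const (1:ℝ)).mono' hQm.aestronglyMeasurable (Filter.Eventually.of_forall bQ)
  have hY : Integrable (fun ω => xl (X ω) * Q ω) μ :=
    Integrable.mul_bdd hXlint hQm.aestronglyMeasurable (Filter.Eventually.of_forall bQ)
  have t1 : μ[(μ[Q | sigmaGen X]) | sigmaGen V] =ᵐ[μ] μ[Q | sigmaGen V] :=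
    condExp_condExp_of_le hVX hmX
  have p1 : μ[(fun ω => xl (X ω) * Q ω) | sigmaGen X] =ᵐ[μ]
      fun ω => xl (X ω) * (μ[Q | sigmaGen X]) ω :=
    condExp_mul_of_stronglyMeasurable_left hXlmeas.stronglyMeasurable hY hQ
  have t2 : μ[(fun ω => xl (X ω) * (μ[Q | sigmaGen X]) ω) | sigmaGen V] =ᵐ[μ]
      μ[(fun ω => xl (X ω) * Q ω) | sigmaGen V] :=
    (condExp_congr_ae p1.symm).trans (condExp_condExp_of_le hVX hmX)
  have hpos : ∀ᵐ ω ∂μ, (μ[Q | sigmaGen V]) ω = 0 → (μ[(fun ω => xl (X ω) * Q ω) | sigmaGen V]) ω = 0 := by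
    let A : Set Ω := {ω | (μ[Q | sigmaGen V]) ω = 0}
    have hA : MeasurableSet[sigmaGen V] A :=
      (stronglyMeasurable_condExp (f := Q) (m := sigmaGen V) (μ := μ)).measurable
        (measurableSet_singleton (0:ℝ))
    have h1 : ∫ ω in A, Q ω ∂μ = 0 := by
      rw [← setIntegral_condExp hmV hQ hA]
      exact setIntegral_eq_zero_of_forall_eq_zero fun ω hω => hω
    have Q0 : ∀ ω, 0 ≤ Q ω := fun ω => by simp only [Q]; split_ifs <;> simp
    have h2 := (setIntegral_eq_zero_iff_of_nonneg_ae (Filter.Eventually.of_forall Q0)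
      hQ.integrableOn).1 h1
    have h3 : A.indicator (fun ω => xl (X ω) * Q ω) =ᵐ[μ] 0 := by
      have h2' := (ae_restrict_iff' (hmV _ hA)).1 h2
      filter_upwards [h2'] with ω hω
      by_cases h : ω ∈ A
      · have := hω h
        simp only [Pi.zero_apply] at this
        simp [h, this]
      · simp [h]
    have h4 := condExp_indicator (m := sigmaGen V) hY hA
    have h5 := condExp_congr_ae (m := sigmaGen V) h3
    rw [condExp_zero] at h5
    filter_upwards [h4, h5] with ω h6 h7 h8
    rw [h7] at h6
    have h9 : ω ∈ A := h8
    simpa [h9] using h6.symm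
  have he : (fun ω => ρ t (V ω) * (μ[Q | sigmaGen V]) ω) =ᵐ[μ]
      μ[(fun ω => xl (X ω) * Q ω) | sigmaGen V] := by
    filter_upwards [hρ t htτ, t1, t2, hpos] with ω h1 h2 h3 h4
    rw [h1]
    simp only [cE, Function.comp_apply]
    change (μ[(fun ω => xl (X ω) * (μ[Q | sigmaGen X]) ω) | sigmaGen V]) ω /
      (μ[(μ[Q | sigmaGen X]) | sigmaGen V]) ω * _ = _
    rw [h2, h3]
    by_cases h5 : (μ[Q | sigmaGen V]) ω = 0
    · rw [h4 h5, h5]; simp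
    · field_simp
  have hwm : Measurable[sigmaGen V] (fun ω => auxDens lam₀ t (V ω) * g t (V ω)) := by
    have h1 : Measurable (fun v => auxDens lam₀ t v * g t v) :=
      ((auxDens_meas hlam₀meas).comp (measurable_const.prodMk measurable_id)).mul
        (hg.comp (measurable_const.prodMk measurable_id))
    exact h1.comp (comap_measurable V)
  have hrm : Measurable[sigmaGen V] (fun ω => ρ t (V ω)) := by
    have h1 : Measurable (fun v => ρ t v) := hρmeas.comp (measurable_const.prodMk measurable_id)
    exact h1.comp (comap_measurable V)
  have efun : ∀ ω, (ENNReal.ofReal (auxDens lam₀ t (L (C ω, X ω).2))).toReal • H (t, C ω, X ω)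
      = auxDens lam₀ t (V ω) * g t (V ω) * (xl (X ω) * Q ω - ρ t (V ω) * Q ω) := by
    intro ω
    rw [ENNReal.toReal_ofReal (auxDens_nonneg hlam₀nn _ _)]
    simp only [H, Q, hVL, smul_eq_mul]
    ring
  have hti' : Integrable (fun ω => auxDens lam₀ t (V ω) * g t (V ω) *
      (xl (X ω) * Q ω - ρ t (V ω) * Q ω)) μ :=
    hti.congr (Filter.Eventually.of_forall efun)
  rw [integral_congr_ae (Filter.Eventually.of_forall efun)]
  exact aux_zero hmV hwm hrm hY hQ he hti'
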